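/- Let X be a finite-dimensional normed space and N : X → X a continuous map. Suppose there exists R > 0 such that ⟨N(x), x⟩ ≥ 0 for all x with ‖x‖ = R. Then there exists x ∈ X with ‖x‖ ≤ R and N(x) = 0. -/

import Mathlib

open RealInnerProductSpace

open Polynomial in
/-- The determinant of `1 + t • A` is a polynomial in `t` of degree at most the dimension. -/
theorem exists_polynomial_eval_eq_det_one_add_smul {E : Type*} [NormedAddCommGroup E]
    [NormedSpace ℝ E] [FiniteDimensional ℝ E] (A : E →L[ℝ] E) :
    ∃ p : ℝ[X], p.natDegree ≤ Module.finrank ℝ E ∧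
      ∀ t : ℝ, p.eval t = (1 + t • A : E →L[ℝ] E).det := by
  let b := Module.finBasis ℝ E
  let M := LinearMap.toMatrix b b (A : E →ₗ[ℝ] E)
  refine ⟨Matrix.det ((X : ℝ[X]) • M.map C + (1 : Matrix _ _ ℝ).map C), ?_, fun t ↦ ?_⟩
  · simpa using natDegree_det_X_add_C_le M 1
  · have h : (1 + t • A : E →L[ℝ] E).det = (1 + t • M).det := by
      rw [ContinuousLinearMap.det, ← LinearMap.det_toMatrix b]
      congr 1
      simp [M, LinearMap.toMatrix_one]
    rw [h, ← coe_evalRingHom, RingHom.map_det]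
    congr 1
    ext i j
    simp [Matrix.one_apply, apply_ite, add_comm, mul_comm t]

/-- Lagrange extrapolation to `t = 1` of `t ↦ det (1 + t • A)`, with weights independent of `A`. -/
theorem exists_weights_det_one_add_eq_sum (E : Type*) [NormedAddCommGroup E]
    [NormedSpace ℝ E] [FiniteDimensional ℝ E] {v : ℕ → ℝ} (hv : Function.Injective v) :
    ∃ (s : Finset ℕ) (c : ℕ → ℝ), ∑ i ∈ s, c i = 1 ∧ ∀ A : E →L[ℝ] E,
      (1 + A).det = ∑ i ∈ s, c i * (1 + v i • A : E →L[ℝ] E).det := by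
  let s := Finset.range (Module.finrank ℝ E + 1)
  refine ⟨s, fun i ↦ (Lagrange.basis s v i).eval 1, ?_, fun A ↦ ?_⟩
  · rw [← Polynomial.eval_finsetSum, Lagrange.sum_basis hv.injOn ⟨0, by simp [s]⟩,
      Polynomial.eval_one]
  · obtain ⟨p, hdeg, hp⟩ := exists_polynomial_eval_eq_det_one_add_smul A
    have hlt : p.degree < s.card := by
      refine Polynomial.degree_le_natDegree.trans_lt ?_
      rw [Finset.card_range]
      exact_mod_cast Order.lt_add_one_iff.2 hdeg
    have h := congrArg (Polynomial.eval 1) (Lagrange.eq_interpolate (s := s) hv.injOn hlt)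
    rw [hp, one_smul, Lagrange.interpolate_apply, Polynomial.eval_finsetSum] at h
    simpa [hp, mul_comm] using h

theorem exists_pos_forall_det_one_add_pos (E : Type*) [NormedAddCommGroup E]
    [NormedSpace ℝ E] [FiniteDimensional ℝ E] :
    ∃ δ > 0, ∀ A : E →L[ℝ] E, ‖A‖ < δ → 0 < (1 + A).det := by
  have hc : ContinuousAt (fun A : E →L[ℝ] E ↦ (1 + A).det) 0 :=
    (ContinuousLinearMap.continuous_det.comp (continuous_const.add continuous_id)).continuousAt
  have h1 : (0 : ℝ) < (1 + (0 : E →L[ℝ] E)).det := by simp [ContinuousLinearMap.det]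
  obtain ⟨δ, hδ, h⟩ := Metric.eventually_nhds_iff.1 (hc.eventually (lt_mem_nhds h1))
  exact ⟨δ, hδ, fun A hA ↦ h (by simpa using hA)⟩

/-- A perturbation of the identity by a contraction supported in `U` permutes `U`. -/
theorem bijOn_add_of_lipschitzWith {E : Type*} [NormedAddCommGroup E] [NormedSpace ℝ E]
    [CompleteSpace E] {U : Set E} {g : E → E} {K : NNReal} (hg : LipschitzWith K g) (hK : K < 1)
    (hU : ∀ x ∉ U, g x = 0) : Set.BijOn (fun x ↦ x + g x) U U := by
  have happ : ApproximatesLinearOn (fun x ↦ x + g x)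
      (ContinuousLinearEquiv.refl ℝ E : E →L[ℝ] E) Set.univ K := by
    intro x _ y _
    have := hg.dist_le_mul x y
    rw [dist_eq_norm, dist_eq_norm] at this
    simpa [add_sub_add_comm] using this
  have hc : Subsingleton E ∨
      K < ‖((ContinuousLinearEquiv.refl ℝ E).symm : E →L[ℝ] E)‖₊⁻¹ := by
    rcases subsingleton_or_nontrivial E with h | h
    · exact Or.inl h
    · right
      have : ‖((ContinuousLinearEquiv.refl ℝ E).symm : E →L[ℝ] E)‖₊ = 1 := by
        ext
        exact ContinuousLinearMap.norm_id
      simpa [this] using hK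
  have hinj : Function.Injective (fun x ↦ x + g x) := Set.injOn_univ.1 (happ.injOn hc)
  refine ⟨fun x hx ↦ ?_, hinj.injOn, fun y hy ↦ ?_⟩
  · by_contra hn
    have h : x + g x = x := hinj (by simp [hU _ hn])
    exact hn (by simpa only [h] using hx)
  · obtain ⟨x, rfl⟩ := happ.surjective hc y
    refine ⟨x, ?_, rfl⟩
    by_contra hn
    exact hn (by simpa [hU x hn] using hy)

open MeasureTheory in
/-- The map `id + g` cannot have a singular derivative throughout a bounded open set outside of
which the Lipschitz map `g` vanishes. -/
theorem exists_det_one_add_fderiv_ne_zero {E : Type*} [NormedAddCommGroup E] [NormedSpace ℝ E]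
    [FiniteDimensional ℝ E] {U : Set E} (hUo : IsOpen U) (hUne : U.Nonempty)
    (hUb : Bornology.IsBounded U) {g : E → E} {K : NNReal} (hg : LipschitzWith K g)
    (hgU : ∀ x ∉ U, g x = 0) (hd : DifferentiableOn ℝ g U) :
    ∃ x ∈ U, (1 + fderiv ℝ g x).det ≠ 0 := by
  by_contra! hdet
  borelize E
  let μ : Measure E := Measure.addHaar
  have hμ : μ U ≠ ⊤ := hUb.measure_lt_top.ne
  obtain ⟨δ, hδ, hpos⟩ := exists_pos_forall_det_one_add_pos E
  let ε : ℝ := min δ 1 / (K + 1)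
  have hε : 0 < ε := by positivity
  have hεK : ε * K < min δ 1 := by
    have h0 : 0 < min δ 1 := by positivity
    have : ε * (K + 1) = min δ 1 := div_mul_cancel₀ _ (by positivity)
    nlinarith
  have key : ∀ t : ℝ, 0 < t → t ≤ ε →
      IntegrableOn (fun x ↦ (1 + t • fderiv ℝ g x : E →L[ℝ] E).det) U μ ∧
        ∫ x in U, (1 + t • fderiv ℝ g x : E →L[ℝ] E).det ∂μ = μ.real U := by
    intro t ht htε
    have htK : t * K < min δ 1 := (mul_le_mul_of_nonneg_right htε K.2).trans_lt hεK
    have hlip : LipschitzWith (t.toNNReal * K) (fun x ↦ t • g x) := by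
      refine LipschitzWith.of_dist_le_mul fun x y ↦ ?_
      rw [dist_smul₀, NNReal.coe_mul, Real.coe_toNNReal _ ht.le, Real.norm_of_nonneg ht.le,
        mul_assoc]
      exact mul_le_mul_of_nonneg_left (hg.dist_le_mul x y) ht.le
    have hbij : Set.BijOn (fun x ↦ x + t • g x) U U := by
      refine bijOn_add_of_lipschitzWith hlip ?_ fun x hx ↦ by simp [hgU x hx]
      rw [← NNReal.coe_lt_coe, NNReal.coe_mul, Real.coe_toNNReal _ ht.le]
      exact htK.trans_le (min_le_right _ _)
    have hderiv : ∀ x ∈ U, HasFDerivWithinAt (fun x ↦ x + t • g x)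
        (1 + t • fderiv ℝ g x : E →L[ℝ] E) U x := fun x hx ↦
      ((hasFDerivAt_id x).add
        ((hd.differentiableAt (hUo.mem_nhds hx)).hasFDerivAt.const_smul t)).hasFDerivWithinAt
    have habs : Set.EqOn (fun x ↦ |(1 + t • fderiv ℝ g x : E →L[ℝ] E).det| • (1 : ℝ))
        (fun x ↦ (1 + t • fderiv ℝ g x : E →L[ℝ] E).det) U := by
      intro x _
      have : 0 < (1 + t • fderiv ℝ g x : E →L[ℝ] E).det := by
        refine hpos _ ?_
        rw [norm_smul, Real.norm_of_nonneg ht.le]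
        exact (mul_le_mul_of_nonneg_left (norm_fderiv_le_of_lipschitz ℝ hg) ht.le).trans_lt
          (htK.trans_le (min_le_left _ _))
      simp [abs_of_pos this]
    have hUm := hUo.measurableSet
    constructor
    · have h := integrableOn_image_iff_integrableOn_abs_det_fderiv_smul μ hUm hderiv hbij.injOn
        (fun _ ↦ (1 : ℝ))
      rw [hbij.image_eq] at h
      exact (h.1 (integrableOn_const hμ)).congr_fun habs hUm
    · have h := integral_image_eq_integral_abs_det_fderiv_smul μ hUm hderiv hbij.injOn
        (fun _ ↦ (1 : ℝ))
      rw [hbij.image_eq, setIntegral_congr_fun hUm habs] at h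
      simpa using h.symm
  let v : ℕ → ℝ := fun i ↦ ε / (i + 1)
  have hv : Function.Injective v := by
    intro i j hij
    have : (i : ℝ) + 1 = j + 1 := by
      simp only [v] at hij
      field_simp at hij
      linarith
    exact_mod_cast add_right_cancel this
  have hv0 : ∀ i, 0 < v i := fun i ↦ by positivity
  have hvε : ∀ i, v i ≤ ε := fun i ↦ div_le_self hε.le (by simp)
  obtain ⟨s, c, hc, hsum⟩ := exists_weights_det_one_add_eq_sum E hv
  have hzero : ∫ x in U, (1 + fderiv ℝ g x).det ∂μ = 0 :=
    setIntegral_eq_zero_of_forall_eq_zero hdet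
  rw [funext fun x ↦ hsum (fderiv ℝ g x)] at hzero
  rw [integral_finsetSum _ fun i _ ↦ ((key _ (hv0 i) (hvε i)).1.const_mul (c i))] at hzero
  simp_rw [integral_const_mul, (key _ (hv0 _) (hvε _)).2] at hzero
  rw [← Finset.sum_mul, hc, one_mul] at hzero
  exact (ENNReal.toReal_pos (hUo.measure_pos μ hUne).ne' hμ).ne' hzero

/-- If `f` has constant nonzero norm near `x`, its derivative at `x` is singular. -/
theorem det_eq_zero_of_norm_eventuallyEq_const {E : Type*} [NormedAddCommGroup E]
    [InnerProductSpace ℝ E] [FiniteDimensional ℝ E] {f : E → E} {f' : E →L[ℝ] E} {x : E} {M : ℝ}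
    (hf : HasFDerivAt f f' x) (hM : ∀ᶠ y in nhds x, ‖f y‖ = M) (h0 : f x ≠ 0) : f'.det = 0 := by
  by_contra hdet
  have hsurj : Function.Surjective f' :=
    (LinearMap.equivOfDetNeZero (f' : E →ₗ[ℝ] E) hdet).surjective
  obtain ⟨w, hw⟩ := hsurj (f x)
  have hconst : HasFDerivAt (fun y ↦ ‖f y‖ ^ 2) (0 : E →L[ℝ] ℝ) x :=
    (hasFDerivAt_const (M ^ 2) x).congr_of_eventuallyEq (hM.mono fun y hy ↦ by simp [hy])
  have h := congrArg (fun L ↦ L w) (hf.norm_sq.unique hconst)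
  simp [hw] at h
  exact h0 h

/-- Pushing vectors radially out to norm at least `M` is Lipschitz away from the origin. -/
theorem dist_max_div_norm_smul_le {E : Type*} [NormedAddCommGroup E] [NormedSpace ℝ E]
    {c M : ℝ} (hc : 0 < c) (hcM : c ≤ M) {x y : E} (hx : c ≤ ‖x‖) (hy : c ≤ ‖y‖) :
    dist (max (M / ‖x‖) 1 • x) (max (M / ‖y‖) 1 • y) ≤ 2 * (M / c) * dist x y := by
  have hx0 := hc.trans_le hx
  have hy0 := hc.trans_le hy
  have hM0 := hc.trans_le hcM
  have hbound : M / ‖x‖ ≤ M / c := by gcongr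
  have h1 : ‖max (M / ‖x‖) 1 • (x - y)‖ ≤ M / c * ‖x - y‖ := by
    rw [norm_smul, Real.norm_of_nonneg (by positivity)]
    gcongr
    exact max_le hbound ((one_le_div hc).2 hcM)
  have h2 : ‖(max (M / ‖x‖) 1 - max (M / ‖y‖) 1) • y‖ ≤ M / c * ‖x - y‖ := by
    rw [norm_smul, Real.norm_eq_abs]
    calc |max (M / ‖x‖) 1 - max (M / ‖y‖) 1| * ‖y‖
        ≤ |M / ‖x‖ - M / ‖y‖| * ‖y‖ := by
          exact mul_le_mul_of_nonneg_right
            (abs_max_sub_max_le_abs (M / ‖x‖) (M / ‖y‖) 1) hy0.le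
      _ = |M / ‖x‖ * (‖y‖ - ‖x‖)| := by
          rw [← abs_of_pos hy0, ← abs_mul, abs_of_pos hy0]
          congr 1
          field_simp
      _ ≤ M / c * ‖x - y‖ := by
          rw [abs_mul, abs_of_pos (by positivity), norm_sub_rev]
          gcongr
          exact abs_norm_sub_norm_le _ _
  rw [dist_eq_norm, dist_eq_norm]
  calc ‖max (M / ‖x‖) 1 • x - max (M / ‖y‖) 1 • y‖
      = ‖max (M / ‖x‖) 1 • (x - y) + (max (M / ‖x‖) 1 - max (M / ‖y‖) 1) • y‖ := by
        congr 1
        module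
    _ ≤ 2 * (M / c) * ‖x - y‖ := by linarith [norm_add_le_of_le h1 h2]

/-- A continuous self-map equal to the identity outside of a ball has a zero. -/
theorem exists_eq_zero_of_eq_id_outside_ball {E : Type*} [NormedAddCommGroup E]
    [InnerProductSpace ℝ E] [FiniteDimensional ℝ E] {H : E → E} (hH : Continuous H) {ρ : ℝ}
    (hρ : 0 < ρ) (hid : ∀ x, ρ ≤ ‖x‖ → H x = x) : ∃ x, H x = 0 := by
  by_contra! hne
  obtain ⟨k, hk, hkH, hks⟩ := (hH.sub continuous_id).exists_contDiff_approx 1 hH.norm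
    (fun x ↦ norm_pos_iff.2 (hne x))
  have hk0 : ∀ x, ρ ≤ ‖x‖ → k x = 0 := by
    intro x hx
    by_contra h
    exact hks h (by simp [hid x hx])
  have hkc : HasCompactSupport k := HasCompactSupport.intro (isCompact_closedBall 0 ρ)
    fun x hx ↦ hk0 x (by simpa using (not_le.1 (by simpa using hx)).le)
  obtain ⟨K, hK⟩ := hk.lipschitzWith_of_hasCompactSupport hkc (by simp)
  let G : E → E := fun x ↦ x + k x
  have hGdiff : Differentiable ℝ G := differentiable_id.add (hk.differentiable (by simp))
  have hGlip : LipschitzWith (1 + K) G := LipschitzWith.id.add hK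
  have hG0 : ∀ x, G x ≠ 0 := by
    intro x hx
    have h := hkH x
    have hkx : k x = -x := eq_neg_of_add_eq_zero_right hx
    rw [dist_eq_norm, hkx, Pi.sub_apply, id, neg_sub_left, sub_add_cancel, norm_neg] at h
    exact h.false
  have hGid : ∀ x, ρ ≤ ‖x‖ → G x = x := fun x hx ↦ by simp [G, hk0 x hx]
  have hball : IsCompact (Metric.closedBall (0 : E) ρ) := isCompact_closedBall 0 ρ
  have hne' : (Metric.closedBall (0 : E) ρ).Nonempty := ⟨0, by simp [hρ.le]⟩
  obtain ⟨a, -, ha⟩ := hball.exists_isMinOn hne' hGdiff.continuous.norm.continuousOn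
  obtain ⟨b, -, hb⟩ := hball.exists_isMaxOn hne' hGdiff.continuous.norm.continuousOn
  let c := min ‖G a‖ ρ
  let M := max ‖G b‖ ρ
  have hc : 0 < c := lt_min (norm_pos_iff.2 (hG0 a)) hρ
  have hM : 0 < M := lt_max_of_lt_right hρ
  have hcM : c ≤ M := (min_le_right _ _).trans (le_max_right _ _)
  have hcG : ∀ x, c ≤ ‖G x‖ := by
    intro x
    rcases le_total ‖x‖ ρ with hx | hx
    · exact (min_le_left _ _).trans (ha (by simpa using hx))
    · rw [hGid x hx]
      exact (min_le_right _ _).trans hx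
  have hGM : ∀ x, ‖x‖ ≤ M → ‖G x‖ ≤ M := by
    intro x hxM
    rcases le_total ‖x‖ ρ with hx | hx
    · exact (hb (a := x) (by simpa using hx)).trans (le_max_left _ _)
    · rwa [hGid x hx]
  let r : E → E := fun x ↦ max (M / ‖G x‖) 1 • G x
  have hr_in : ∀ x, ‖x‖ ≤ M → r x = (M / ‖G x‖) • G x := by
    intro x hx
    simp only [r]
    rw [max_eq_left ((one_le_div (norm_pos_iff.2 (hG0 x))).2 (hGM x hx))]
  have hr_norm : ∀ x, ‖x‖ ≤ M → ‖r x‖ = M := by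
    intro x hx
    rw [hr_in x hx, norm_smul, Real.norm_of_nonneg (by positivity),
      div_mul_cancel₀ _ (norm_pos_iff.2 (hG0 x)).ne']
  have hr_out : ∀ x, M ≤ ‖x‖ → r x = x := by
    intro x hx
    simp only [r]
    rw [hGid x ((le_max_right _ _).trans hx), max_eq_right, one_smul]
    exact (div_le_one (hM.trans_le hx)).2 hx
  have hr_lip : LipschitzWith (2 * (M / c).toNNReal * (1 + K)) r := by
    refine LipschitzWith.of_dist_le_mul fun x y ↦ ?_
    have h := (dist_max_div_norm_smul_le hc hcM (hcG x) (hcG y)).trans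
      (mul_le_mul_of_nonneg_left (hGlip.dist_le_mul x y) (by positivity))
    rw [← mul_assoc] at h
    rw [NNReal.coe_mul, NNReal.coe_mul, Real.coe_toNNReal _ (by positivity)]
    exact h
  have hmem : ∀ x ∈ Metric.ball (0 : E) M, ∀ᶠ y in nhds x, ‖y‖ ≤ M := fun x hx ↦
    (Metric.isOpen_ball.eventually_mem hx).mono fun y hy ↦ (mem_ball_zero_iff.1 hy).le
  have hr_diff : ∀ x ∈ Metric.ball (0 : E) M, DifferentiableAt ℝ r x := by
    intro x hx
    have hd : DifferentiableAt ℝ (fun x ↦ M / ‖G x‖) x :=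
      (((hGdiff x).norm ℝ (hG0 x)).fun_inv (norm_ne_zero_iff.2 (hG0 x))).const_mul M
    exact (hd.fun_smul (hGdiff x)).congr_of_eventuallyEq ((hmem x hx).mono hr_in)
  obtain ⟨x, hx, hdet⟩ := exists_det_one_add_fderiv_ne_zero Metric.isOpen_ball
    ⟨0, Metric.mem_ball_self hM⟩ Metric.isBounded_ball (hr_lip.sub LipschitzWith.id)
    (fun x hx ↦ by simp [hr_out x (by simpa using hx)])
    (fun x hx ↦ ((hr_diff x hx).sub differentiableAt_id).differentiableWithinAt)
  refine hdet (det_eq_zero_of_norm_eventuallyEq_const (f := r) (x := x) (M := M) ?_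
    ((hmem x hx).mono hr_norm) ?_)
  · have h := (hasFDerivAt_id x).add ((hr_diff x hx).sub differentiableAt_id).hasFDerivAt
    exact h.congr_of_eventuallyEq (Filter.Eventually.of_forall fun y ↦ by simp)
  · rw [← norm_pos_iff, hr_norm x (mem_ball_zero_iff.1 hx).le]
    exact hM

/-- Corollary of Brouwer's fixed point theorem (Girault–Raviart IV.1.1):
if X is a finite-dimensional real inner product space and N : X → X is
continuous with ⟨N(x), x⟩ ≥ 0 for all ‖x‖ = R (R > 0), then there exists
x with ‖x‖ ≤ R and N(x) = 0. -/
theorem brouwer_zero_of_nonneg_on_sphere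
    {X : Type*} [NormedAddCommGroup X] [InnerProductSpace ℝ X]
    [FiniteDimensional ℝ X]
    (N : X → X) (hN : Continuous N) (R : ℝ) (hR : 0 < R)
    (hpos : ∀ x : X, ‖x‖ = R → 0 ≤ ⟪N x, x⟫) :
    ∃ x : X, ‖x‖ ≤ R ∧ N x = 0 := by
  let s : X → ℝ := fun x ↦ min (max (‖x‖ / R - 1) 0) 1
  let p : X → X := fun x ↦ (R / max R ‖x‖) • x
  have hmax : ∀ x : X, max R ‖x‖ ≠ 0 := fun x ↦ (lt_max_of_lt_left hR).ne'
  have hp : Continuous p :=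
    (continuous_const.div (continuous_const.max continuous_norm) hmax).smul continuous_id
  have hs : Continuous s := by fun_prop
  obtain ⟨x, hx⟩ := exists_eq_zero_of_eq_id_outside_ball
    (H := fun x ↦ (1 - s x) • N (p x) + s x • x) (by fun_prop) (ρ := 2 * R) (by positivity)
    (by
      intro x hx
      have h : 1 ≤ ‖x‖ / R - 1 := by
        rw [le_sub_iff_add_le, le_div_iff₀ hR]
        linarith
      have : s x = 1 := min_eq_right (h.trans (le_max_left _ _))
      simp [this])
  have hxR : ‖x‖ ≤ R := by
    by_contra! hlt
    have hx0 : 0 < ‖x‖ := hR.trans hlt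
    have hpx : p x = (R / ‖x‖) • x := by simp only [p, max_eq_right hlt.le]
    have hs0 : 0 < s x :=
      lt_min (lt_max_of_lt_left (sub_pos.2 ((one_lt_div hR).2 hlt))) one_pos
    have hs1 : s x ≤ 1 := min_le_right _ _
    have h1 : 0 ≤ ⟪N (p x), p x⟫ := hpos _ (by
      rw [hpx, norm_smul, Real.norm_of_nonneg (by positivity), div_mul_cancel₀ _ hx0.ne'])
    have h2 : 0 ≤ ⟪N (p x), x⟫ := by
      nth_rw 2 [hpx] at h1
      rw [real_inner_smul_right] at h1
      exact nonneg_of_mul_nonneg_right h1 (by positivity)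
    have h3 : (1 - s x) * ⟪N (p x), x⟫ + s x * ‖x‖ ^ 2 = 0 := by
      have := congrArg (fun y ↦ ⟪y, x⟫) hx
      simpa [inner_add_left, real_inner_smul_left] using this
    have h4 : 0 ≤ (1 - s x) * ⟪N (p x), x⟫ := mul_nonneg (sub_nonneg.2 hs1) h2
    have h5 : 0 < s x * ‖x‖ ^ 2 := by positivity
    linarith
  refine ⟨x, hxR, ?_⟩
  have hs0 : s x = 0 := by
    have : ‖x‖ / R - 1 ≤ 0 := sub_nonpos.2 ((div_le_one hR).2 hxR)
    simp [s, max_eq_right this]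
  have hpx : p x = x := by simp [p, max_eq_left hxR, hR.ne']
  simpa [hs0, hpx] using hx
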